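/- There exists no ideal cardinal comparison test; that is, no cardinal comparison test is ideal with respect to the set of all probability measures on Ω^∞. -/

import Mathlib

open MeasureTheory Filter Set
open scoped ENNReal

/-- The space Ω^∞ of infinite binary sequences. -/
abbrev BinSeq : Type := ℕ → Bool

/-- The cylinder set `[ω^t]` of sequences agreeing with `ω` in the first `t` coordinates. -/
def cyl (ω : BinSeq) (t : ℕ) : Set BinSeq := {ω' | ∀ i < t, ω' i = ω i}

/-- A (candidate) cardinal comparison test: to each ordered pair of measures, each time `t`
and each realization `ω` it assigns a number. -/
abbrev Test : Type := Measure BinSeq → Measure BinSeq → ℕ → BinSeq → ℝ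

/-- The σ-algebra on `BinSeq` generated by the first `t` coordinates. -/
def coordAlg (t : ℕ) : MeasurableSpace BinSeq :=
  MeasurableSpace.comap (fun ω (i : Fin t) => ω (i : ℕ)) inferInstance

/-- A cardinal comparison test: values in `[0,1]`, and `T_t` is measurable with respect to the
σ-algebra generated by the first `t` coordinates, for every `t ≥ 1`. -/
def IsCCTest (T : Test) : Prop :=
  ∀ f g : Measure BinSeq, IsProbabilityMeasure f → IsProbabilityMeasure g →
    ∀ t : ℕ, 1 ≤ t →
      (∀ ω, T f g t ω ∈ Set.Icc (0:ℝ) 1) ∧ @Measurable BinSeq ℝ (coordAlg t) _ (T f g t)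

/-- `L_{T,ε}^{(f,g)}`: the set of `ω` where `lim_t T_t(ω,f,g)` exists and is `> ε`. -/
def LSet (T : Test) (f g : Measure BinSeq) (ε : ℝ) : Set BinSeq :=
  {ω | ∃ l : ℝ, Tendsto (fun t => T f g t ω) atTop (nhds l) ∧ ε < l}

/-- `R_{T,ε}^{(f,g)}`: the set of `ω` where `lim_t T_t(ω,f,g)` exists and is `< ε`. -/
def RSet (T : Test) (f g : Measure BinSeq) (ε : ℝ) : Set BinSeq :=
  {ω | ∃ l : ℝ, Tendsto (fun t => T f g t ω) atTop (nhds l) ∧ l < ε}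

/-- Anonymity: `T_t(ω,f,g) = 1 - T_t(ω,g,f)`. -/
def Anonymous (T : Test) : Prop :=
  ∀ f g : Measure BinSeq, IsProbabilityMeasure f → IsProbabilityMeasure g →
    ∀ t : ℕ, 1 ≤ t → ∀ ω, T f g t ω = 1 - T g f t ω

/-- Error-freeness. -/
def ErrorFree (T : Test) : Prop :=
  ∀ f g : Measure BinSeq, IsProbabilityMeasure f → IsProbabilityMeasure g →
    ∀ A : Set BinSeq, MeasurableSet A →
      (∀ ε : ℝ, ε ∈ Set.Ioo 0 (1/2) →
        f (A ∩ RSet T f g ε) ≤ ENNReal.ofReal (ε / (1 - ε)) * g (A ∩ RSet T f g ε)) ∧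
      (∀ ε : ℝ, ε ∈ Set.Ioo (1/2) 1 →
        g (A ∩ LSet T f g ε) ≤ ENNReal.ofReal ((1 - ε) / ε) * f (A ∩ LSet T f g ε))

/-- Reasonableness. -/
def Reasonable (T : Test) : Prop :=
  ∀ f g : Measure BinSeq, IsProbabilityMeasure f → IsProbabilityMeasure g →
    ∀ A : Set BinSeq, MeasurableSet A →
      (∀ ε : ℝ, ε ∈ Set.Ioo 0 (1/2) →
        0 < g A → f A < ENNReal.ofReal (ε / (1 - ε)) * g A →
          0 < g (A ∩ RSet T f g ε)) ∧
      (∀ ε : ℝ, ε ∈ Set.Ioo (1/2) 1 →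
        0 < f A → g A < ENNReal.ofReal ((1 - ε) / ε) * f A →
          0 < f (A ∩ LSet T f g ε))

/-- The finite derivative test `D`. -/
noncomputable def Dtest : Test := fun f g t ω =>
  match t with
  | 0 => 1/2
  | Nat.succ s =>
      if 0 < f (cyl ω s) + g (cyl ω s) then
        (f (cyl ω s)).toReal / ((f (cyl ω s)).toReal + (g (cyl ω s)).toReal)
      else 1/2


/-- A test is ideal with respect to a set `𝒜` of (probability) measures if whenever the two
experts use distinct measures from `𝒜`, each surely believes the test will be decisive on
himself. -/
def IdealWrt (T : Test) (𝒜 : Set (Measure BinSeq)) : Prop :=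
  ∀ f g : Measure BinSeq, f ∈ 𝒜 → g ∈ 𝒜 → f ≠ g →
    f {ω | Tendsto (fun t => T f g t ω) atTop (nhds 1)} = 1 ∧
    g {ω | Tendsto (fun t => T f g t ω) atTop (nhds 0)} = 1

/-- There exists no ideal cardinal comparison test. -/
theorem stmt15 :
    ¬ ∃ T : Test, IsCCTest T ∧ IdealWrt T {μ : Measure BinSeq | IsProbabilityMeasure μ} := by
  rintro ⟨T, -, hT⟩
  set a : BinSeq := fun _ => false
  set b : BinSeq := fun _ => true
  have hab : b ≠ a := fun h => Bool.noConfusion (congrFun h 0)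
  set f : Measure BinSeq := Measure.dirac a
  set g : Measure BinSeq := (2⁻¹ : ℝ≥0∞) • Measure.dirac a + (2⁻¹ : ℝ≥0∞) • Measure.dirac b
  have hf : IsProbabilityMeasure f := inferInstance
  have hg : IsProbabilityMeasure g := ⟨by simp [g, ENNReal.inv_two_add_inv_two]⟩
  have hgb : g {a}ᶜ = 2⁻¹ := by simp [g, hab]
  have hfg : f ≠ g := by
    intro h
    rw [← h] at hgb
    exact absurd hgb.symm (by simp [f])
  obtain ⟨h1, h0⟩ := hT f g hf hg hfg
  have ha1 : Tendsto (fun t => T f g t a) atTop (nhds 1) := by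
    by_contra hn
    simp [f, hn] at h1
  have ha0 : Tendsto (fun t => T f g t a) atTop (nhds 0) := by
    by_contra hn
    have hle : g {ω | Tendsto (fun t => T f g t ω) atTop (nhds 0)} ≤ g {a}ᶜ :=
      measure_mono fun ω hω h => hn (mem_singleton_iff.mp h ▸ hω)
    rw [h0, hgb] at hle
    exact absurd hle (not_le.mpr (by simp))
  exact one_ne_zero (tendsto_nhds_unique ha1 ha0)
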